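/- In a stable inference system over conclusions κ = Bool × Tag × Lit, let compl : Lit → Lit be an involution (compl (compl q) = q), and let d, Δ : Tag have conditions C_d, C_Δ : Lit → List κ → Prop such that for all q and P: Rule (true, d, q) P ↔ C_d q P and Rule (true, Δ, q) P ↔ C_Δ q P. If for every proof P and every literal q, C_d q P ∧ C_d (compl q) P implies C_Δ q P ∧ C_Δ (compl q) P, then the inference rule +d is consistent: for every literal q, if (true, d, q) and (true, d, compl q) are both derivable, then (true, Δ, q) and (true, Δ, compl q) are both derivable. -/

import Mathlib

def IsProof {κ : Type} (Rule : κ → List κ → Prop) (P : List κ) : Prop :=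
  ∀ i : Fin P.length, Rule (P.get i) (P.take i.1)

def Stable {κ : Type} (Rule : κ → List κ → Prop) : Prop :=
  ∀ (c : κ) (P Q : List κ), P.Sublist Q → Rule c P → Rule c Q

def Derivable {κ : Type} (Rule : κ → List κ → Prop) (c : κ) : Prop :=
  ∃ P, IsProof Rule P ∧ c ∈ P

section

variable {κ : Type} {Rule : κ → List κ → Prop} {P Q : List κ} {c : κ}

theorem IsProof.append (hstable : Stable Rule) (hP : IsProof Rule P) (hQ : IsProof Rule Q) :
    IsProof Rule (P ++ Q) := by
  rintro ⟨i, hi⟩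
  simp only [List.get_eq_getElem]
  by_cases h : i < P.length
  · rw [List.getElem_append_left h, List.take_append_of_le_length h.le]
    exact hP ⟨i, h⟩
  · have h' : i - P.length < Q.length := by
      rw [List.length_append] at hi
      omega
    rw [List.getElem_append_right (not_lt.mp h), List.take_append]
    exact hstable _ _ _ (List.sublist_append_right _ _) (hQ ⟨i - P.length, h'⟩)

theorem IsProof.rule_of_mem (hstable : Stable Rule) (hP : IsProof Rule P) (hc : c ∈ P) :
    Rule c P := by
  obtain ⟨i, rfl⟩ := List.get_of_mem hc
  exact hstable _ _ _ (List.take_sublist _ _) (hP i)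

theorem IsProof.derivable_of_rule (hP : IsProof Rule P) (hc : Rule c P) : Derivable Rule c := by
  refine ⟨P ++ [c], ?_, by simp⟩
  rintro ⟨i, hi⟩
  simp only [List.get_eq_getElem]
  by_cases h : i < P.length
  · rw [List.getElem_append_left h, List.take_append_of_le_length h.le]
    exact hP ⟨i, h⟩
  · obtain rfl : i = P.length := by
      rw [List.length_append, List.length_singleton] at hi
      omega
    simpa using hc

end

theorem sufficient_condition_for_consistency {Tag Lit : Type}
    (Rule : (Bool × Tag × Lit) → List (Bool × Tag × Lit) → Prop)
    (hstable : Stable Rule)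
    (compl : Lit → Lit) (hcompl : ∀ q, compl (compl q) = q)
    (d Δ : Tag)
    (Cd CΔ : Lit → List (Bool × Tag × Lit) → Prop)
    (hd : ∀ q P, Rule (true, d, q) P ↔ Cd q P)
    (hΔ : ∀ q P, Rule (true, Δ, q) P ↔ CΔ q P)
    (hcond : ∀ (P : List (Bool × Tag × Lit)) (q : Lit), IsProof Rule P →
      Cd q P ∧ Cd (compl q) P → CΔ q P ∧ CΔ (compl q) P) :
    ∀ q : Lit, Derivable Rule (true, d, q) → Derivable Rule (true, d, compl q) →
      Derivable Rule (true, Δ, q) ∧ Derivable Rule (true, Δ, compl q) := by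
  rintro q ⟨P, hP, hqP⟩ ⟨Q, hQ, hqQ⟩
  have hPQ := hP.append hstable hQ
  obtain ⟨h₁, h₂⟩ := hcond (P ++ Q) q hPQ
    ⟨(hd _ _).mp (hPQ.rule_of_mem hstable (List.mem_append_left _ hqP)),
      (hd _ _).mp (hPQ.rule_of_mem hstable (List.mem_append_right _ hqQ))⟩
  exact ⟨hPQ.derivable_of_rule ((hΔ _ _).mpr h₁), hPQ.derivable_of_rule ((hΔ _ _).mpr h₂)⟩
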